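/- Let X be a finite set with |X| ≥ 5. There is no consensus method on X, defined on profiles of binary trees (a family of functions φ_Y^k : RBP(Y)^k → RP(Y) for every nonempty Y ⊆ X and every k ≥ 1), that is regular and extension stable on binary trees. -/

import Mathlib

open Set

variable {α : Type*}

/-- `T` is the hierarchy of clusters of a rooted phylogenetic tree on the taxon set `X`:
a family of nonempty subsets of `X` containing `X` itself and all singletons, in which
any two members intersect trivially (`A ∩ B ∈ {∅, A, B}`). -/
def IsHierarchy (X : Set α) (T : Set (Set α)) : Prop :=
  (∀ C ∈ T, C ⊆ X ∧ C.Nonempty) ∧ X ∈ T ∧ (∀ x ∈ X, ({x} : Set α) ∈ T) ∧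
    ∀ A ∈ T, ∀ B ∈ T, A ∩ B = ∅ ∨ A ∩ B = A ∨ A ∩ B = B

/-- `RP X`: rooted phylogenetic trees on `X`, modeled as their hierarchies of clusters. -/
def RP (X : Set α) : Set (Set (Set α)) := {T | IsHierarchy X T}

/-- Restriction `T|_Y` of a tree to a subset `Y` of the taxa:
`T|_Y = {C ∩ Y : C ∈ T, C ∩ Y ≠ ∅}`. -/
def restrictTree (Y : Set α) (T : Set (Set α)) : Set (Set α) :=
  {D | ∃ C ∈ T, D = C ∩ Y ∧ (C ∩ Y).Nonempty}

/-- A tree is binary iff it is maximal in `(RP X, ⊆)`. -/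
def IsBinary (X : Set α) (T : Set (Set α)) : Prop :=
  T ∈ RP X ∧ ∀ T' ∈ RP X, T ⊆ T' → T' = T

/-- `RBP X`: rooted binary phylogenetic trees on `X`. -/
def RBP (X : Set α) : Set (Set (Set α)) := {T | IsBinary X T}

/-- Relabeling a tree along a map `σ`: `σ·T = {σ(C) : C ∈ T}`. -/
def mapTree (σ : α → α) (T : Set (Set α)) : Set (Set α) := (Set.image σ) '' T

/-- caterpillar tree of a list (root end first) -/
def cat : List α → Set (Set α)
  | [] => ∅
  | x :: l => {{y | y ∈ x :: l}, {x}} ∪ cat l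

theorem cat_top (l : List α) (h : l ≠ []) : {y | y ∈ l} ∈ cat l := by
  cases l with
  | nil => exact absurd rfl h
  | cons x l => left; left; rfl

theorem cat_sub (l : List α) : ∀ C ∈ cat l, C ⊆ {y | y ∈ l} ∧ C.Nonempty := by
  induction l with
  | nil => intro C h; exact absurd h (by simp [cat])
  | cons x l ih =>
    rintro C ((rfl | rfl) | h)
    · exact ⟨subset_rfl, x, by simp⟩
    · exact ⟨by simp, by simp⟩
    · refine ⟨fun y hy => ?_, (ih C h).2⟩
      have := (ih C h).1 hy
      simp only [mem_ofPred_eq] at this ⊢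
      exact List.mem_cons_of_mem _ this

theorem cat_sing (l : List α) : ∀ x ∈ l, ({x} : Set α) ∈ cat l := by
  induction l with
  | nil => simp
  | cons y l ih =>
    intro x hx
    rcases List.mem_cons.1 hx with rfl | h
    · left; right; rfl
    · right; exact ih x h

theorem cat_compat (l : List α) (hl : l.Nodup) :
    ∀ A ∈ cat l, ∀ B ∈ cat l, A ∩ B = ∅ ∨ A ∩ B = A ∨ A ∩ B = B := by
  induction l with
  | nil => intro A h; exact absurd h (by simp [cat])
  | cons x l ih =>
    have hx := (List.nodup_cons.1 hl).1
    have ih := ih (List.nodup_cons.1 hl).2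
    have key : ∀ A ∈ cat l, ({x} : Set α) ∩ A = ∅ := by
      intro A hA
      ext y
      simp only [mem_inter_iff, mem_singleton_iff, mem_empty_iff_false, iff_false]
      rintro ⟨rfl, h⟩
      exact hx ((cat_sub l A hA).1 h)
    intro A hA B hB
    have sA := (cat_sub _ A hA).1
    have sB := (cat_sub _ B hB).1
    rcases hA with (rfl | rfl) | hA
    · right; right; exact inter_eq_right.2 sB
    · rcases hB with (rfl | rfl) | hB
      · right; left; exact inter_eq_left.2 sA
      · right; left; simp
      · left; exact key B hB
    · rcases hB with (rfl | rfl) | hB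
      · right; left; exact inter_eq_left.2 sA
      · left; rw [inter_comm]; exact key A hA
      · exact ih A hA B hB

theorem cat_max (l : List α) (hl : l.Nodup) (C : Set α) (hC : C.Nonempty)
    (hs : C ⊆ {y | y ∈ l})
    (hc : ∀ B ∈ cat l, C ∩ B = ∅ ∨ C ∩ B = C ∨ C ∩ B = B) : C ∈ cat l := by
  induction l with
  | nil => obtain ⟨x, hx⟩ := hC; exact absurd (hs hx) (by simp)
  | cons x l ih =>
    have hx := (List.nodup_cons.1 hl).1
    by_cases hxC : x ∈ C
    · left
      by_cases hn : l = []
      · subst hn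
        right
        ext y
        constructor
        · intro hy; simpa using hs hy
        · rintro rfl; exact hxC
      · rcases hc _ (Or.inr (cat_top l hn)) with h | h | h
        · right
          ext y
          constructor
          · intro hy
            rcases List.mem_cons.1 (hs hy) with h1 | h1
            · exact h1
            · have : y ∈ C ∩ {y | y ∈ l} := ⟨hy, h1⟩
              rw [h] at this; exact absurd this (by simp)
          · rintro rfl; exact hxC
        · rw [← h] at hxC; exact absurd hxC.2 hx
        · left
          apply subset_antisymm hs
          intro y hy
          rcases List.mem_cons.1 hy with rfl | h1
          · exact hxC
          · have : y ∈ C ∩ {y | y ∈ l} := by rw [h]; exact h1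
            exact this.1
    · right
      apply ih (List.nodup_cons.1 hl).2
      · intro y hy
        rcases List.mem_cons.1 (hs hy) with rfl | h1
        · exact absurd hy hxC
        · exact h1
      · intro B hB; exact hc B (Or.inr hB)

theorem cat_RBP (l : List α) (hl : l.Nodup) (h : l ≠ []) : cat l ∈ RBP {y | y ∈ l} := by
  refine ⟨⟨cat_sub l, cat_top l h, cat_sing l, cat_compat l hl⟩, ?_⟩
  intro T' hT' hsub
  apply subset_antisymm _ hsub
  intro C hC
  exact cat_max l hl C (hT'.1 C hC).2 (hT'.1 C hC).1 fun B hB => hT'.2.2.2 C hC B (hsub hB)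

theorem cat_map (σ : α → α) (l : List α) : mapTree σ (cat l) = cat (l.map σ) := by
  unfold mapTree
  induction l with
  | nil => simp [cat]
  | cons x l ih =>
    have : σ '' {y | y ∈ x :: l} = {y | y ∈ σ x :: l.map σ} := by
      ext y; simp [eq_comm]
    simp only [cat, image_union, image_pair, ih, List.map_cons, this, image_singleton]

theorem restrict_union (Y : Set α) (S T : Set (Set α)) :
    restrictTree Y (S ∪ T) = restrictTree Y S ∪ restrictTree Y T := by
  ext D; simp only [restrictTree, mem_ofPred_eq, mem_union]; grind

theorem restrict_pair (Y A B : Set α) (hA : (A ∩ Y).Nonempty) (hB : (B ∩ Y).Nonempty) :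
    restrictTree Y {A, B} = {A ∩ Y, B ∩ Y} := by
  ext D; simp only [restrictTree, mem_ofPred_eq, mem_insert_iff, mem_singleton_iff]; grind

theorem cat_restrict_in (Z : Set α) (l : List α) (x : α) (m : List α) (hx : x ∈ Z)
    (hl : restrictTree Z (cat l) = cat m) (hm : {y | y ∈ l} ∩ Z = {y | y ∈ m}) :
    restrictTree Z (cat (x :: l)) = cat (x :: m) ∧
      {y | y ∈ x :: l} ∩ Z = {y | y ∈ x :: m} := by
  have h1 : {y | y ∈ x :: l} ∩ Z = {y | y ∈ x :: m} := by
    ext y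
    have := Set.ext_iff.1 hm y
    simp only [mem_inter_iff, mem_ofPred_eq, List.mem_cons] at this ⊢
    grind
  refine ⟨?_, h1⟩
  have h2 : {x} ∩ Z = {x} := by simpa using hx
  rw [cat, restrict_union, hl, restrict_pair, h1, h2]; rfl
  · exact ⟨x, by simp, hx⟩
  · exact ⟨x, by simp, hx⟩

theorem cat_restrict_out (Z : Set α) (l : List α) (x : α) (m : List α) (hx : x ∉ Z)
    (hl : restrictTree Z (cat l) = cat m) (hm : {y | y ∈ l} ∩ Z = {y | y ∈ m}) :
    restrictTree Z (cat (x :: l)) = cat m ∧ {y | y ∈ x :: l} ∩ Z = {y | y ∈ m} := by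
  have h1 : {y | y ∈ x :: l} ∩ Z = {y | y ∈ m} := by
    ext y
    have := Set.ext_iff.1 hm y
    simp only [mem_inter_iff, mem_ofPred_eq, List.mem_cons] at this ⊢
    grind
  refine ⟨?_, h1⟩
  rw [cat, restrict_union, hl]
  apply union_eq_right.2
  rintro D ⟨C, (rfl | rfl), rfl, hne⟩
  · rw [h1] at hne ⊢
    apply cat_top
    rintro rfl
    simp at hne
  · obtain ⟨y, hy, hz⟩ := hne
    rw [mem_singleton_iff] at hy
    subst hy
    exact absurd hz hx

open Classical in
theorem cat_restrict (Z : Set α) (l : List α) :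
    restrictTree Z (cat l) = cat (l.filter (fun x => decide (x ∈ Z))) ∧
      {y | y ∈ l} ∩ Z = {y | y ∈ l.filter (fun x => decide (x ∈ Z))} := by
  induction l with
  | nil => simp [cat, restrictTree]
  | cons x l ih =>
    by_cases hx : x ∈ Z
    · rw [List.filter_cons_of_pos (by simpa using hx)]
      exact cat_restrict_in Z l x _ hx ih.1 ih.2
    · rw [List.filter_cons_of_neg (by simpa using hx)]
      exact cat_restrict_out Z l x _ hx ih.1 ih.2

theorem set_list_sub (l m : List α) (h : ∀ x ∈ l, x ∈ m) : {y | y ∈ l} ⊆ {y | y ∈ m} :=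
  fun x hx => h x hx

theorem set_list_ext (l m : List α) (h : ∀ x ∈ l, x ∈ m) (h' : ∀ x ∈ m, x ∈ l) :
    {y | y ∈ l} = {y | y ∈ m} :=
  subset_antisymm (set_list_sub _ _ h) (set_list_sub _ _ h')

theorem exists_five (X : Set α) (hX5 : 5 ≤ X.ncard) :
    ∃ a b c d e : α, [a, b, c, d, e].Nodup ∧ ∀ x ∈ [a, b, c, d, e], x ∈ X := by
  obtain ⟨s, hs, hc⟩ := Set.exists_subset_card_eq hX5
  have hf : s.Finite := Set.finite_of_ncard_pos (by omega)
  have hlen : hf.toFinset.toList.length = 5 := by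
    rw [Finset.length_toList, ← Set.ncard_eq_toFinset_card s hf, hc]
  have hnd := hf.toFinset.nodup_toList
  have hmem : ∀ x ∈ hf.toFinset.toList, x ∈ X := fun x hx => hs (by simpa using hx)
  generalize hf.toFinset.toList = L at *
  match L, hlen with
  | [a, b, c, d, e], _ => exact ⟨a, b, c, d, e, hnd, hmem⟩

open Classical in
theorem filt_aux (a b c e : α) (hab : a ≠ b) (hac : a ≠ c) (hae : a ≠ e) (hbc : b ≠ c)
    (hbe : b ≠ e) (hce : c ≠ e) :
    restrictTree {y | y ∈ [a, b, e]} (cat [c, a, b, e]) = cat [a, b, e] ∧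
    restrictTree {y | y ∈ [a, b, e]} (cat [a, b, c, e]) = cat [a, b, e] := by
  rw [(cat_restrict _ _).1, (cat_restrict _ _).1]
  simp [List.filter_cons, hac.symm, hbc.symm, hce]

open Classical in
theorem filt_aux2 (a b c d e : α) (had : a ≠ d) (hac : a ≠ c) (hbd : b ≠ d) (hbc : b ≠ c)
    (hcd : c ≠ d) (hde : d ≠ e) (hce : c ≠ e) :
    restrictTree {y | y ∈ [a, b, c, e]} (cat [c, d, a, b, e]) = cat [c, a, b, e] ∧
    restrictTree {y | y ∈ [a, b, c, e]} (cat [a, b, c, d, e]) = cat [a, b, c, e] ∧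
    restrictTree {y | y ∈ [a, b, d, e]} (cat [c, d, a, b, e]) = cat [d, a, b, e] ∧
    restrictTree {y | y ∈ [a, b, d, e]} (cat [a, b, c, d, e]) = cat [a, b, d, e] := by
  rw [(cat_restrict _ _).1, (cat_restrict _ _).1, (cat_restrict _ _).1, (cat_restrict _ _).1]
  simp [List.filter_cons, had.symm, hac.symm, hbd.symm, hbc.symm, hcd.symm, hcd, hde, hce]

open Classical in
theorem exists_sigma (a b c d e : α) (hab : a ≠ b) (hac : a ≠ c) (had : a ≠ d) (hae : a ≠ e)
    (hbc : b ≠ c) (hbd : b ≠ d) (hbe : b ≠ e) (hcd : c ≠ d) (hce : c ≠ e) (hde : d ≠ e) :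
    ∃ σ : α → α, σ a = c ∧ σ b = d ∧ σ c = a ∧ σ d = b ∧ σ e = e ∧ ∀ x, σ (σ x) = x := by
  refine ⟨fun x => Equiv.swap a c (Equiv.swap b d x), ?_, ?_, ?_, ?_, ?_, ?_⟩
  · simp [Equiv.swap_apply_of_ne_of_ne hab had]
  · simp [Equiv.swap_apply_of_ne_of_ne had.symm hcd.symm]
  · simp [Equiv.swap_apply_of_ne_of_ne hbc.symm hcd]
  · simp [Equiv.swap_apply_of_ne_of_ne hab.symm hbc]
  · simp [Equiv.swap_apply_of_ne_of_ne hbe.symm hde.symm,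
      Equiv.swap_apply_of_ne_of_ne hae.symm hce.symm]
  · intro x
    simp only [Equiv.swap_apply_def]
    grind

open Classical in
theorem exists_tau (a b c d e : α) (hac : a ≠ c) (had : a ≠ d)
    (hbc : b ≠ c) (hbd : b ≠ d) (hce : c ≠ e) (hde : d ≠ e) :
    ∃ τ : α → α, τ a = a ∧ τ b = b ∧ τ d = c ∧ τ e = e ∧ Function.Injective τ :=
  ⟨Equiv.swap c d, Equiv.swap_apply_of_ne_of_ne hac had, Equiv.swap_apply_of_ne_of_ne hbc hbd,
    Equiv.swap_apply_right c d, Equiv.swap_apply_of_ne_of_ne hce.symm hde.symm,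
    (Equiv.swap c d).injective⟩

/-- For any finite taxon set `X` with at least 5 elements, there is no
consensus method on `X` defined on profiles of binary trees (a family
`φ k Y : RBP(Y)^k → RP(Y)` for all `k ≥ 1` and nonempty `Y ⊆ X`) that is regular and
extension stable on binary trees. -/
theorem no_regular_extension_stable_consensus_method_on_binary_trees
    (X : Set α) (hXfin : X.Finite) (hX5 : 5 ≤ X.ncard) :
    ¬ ∃ φ : (k : ℕ) → Set α → (Fin k → Set (Set α)) → Set (Set α),
      -- `φ k Y` maps profiles of binary trees on `Y` to trees on `Y`
      (∀ k, 1 ≤ k → ∀ Y : Set α, Y.Nonempty → Y ⊆ X →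
        ∀ Ts : Fin k → Set (Set α), (∀ i, Ts i ∈ RBP Y) → φ k Y Ts ∈ RP Y) ∧
      -- unanimity
      (∀ k, 1 ≤ k → ∀ Y : Set α, Y.Nonempty → Y ⊆ X →
        ∀ T ∈ RBP Y, φ k Y (fun _ => T) = T) ∧
      -- anonymity
      (∀ k, 1 ≤ k → ∀ Y : Set α, Y.Nonempty → Y ⊆ X →
        ∀ Ts : Fin k → Set (Set α), (∀ i, Ts i ∈ RBP Y) →
          ∀ π : Equiv.Perm (Fin k), φ k Y (Ts ∘ π) = φ k Y Ts) ∧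
      -- neutrality: any bijection `σ : Y → Y'` between nonempty subsets of `X`
      (∀ k, 1 ≤ k → ∀ Y : Set α, Y.Nonempty → Y ⊆ X →
        ∀ σ : α → α, Set.InjOn σ Y → σ '' Y ⊆ X →
          ∀ Ts : Fin k → Set (Set α), (∀ i, Ts i ∈ RBP Y) →
            φ k (σ '' Y) (fun i => mapTree σ (Ts i)) = mapTree σ (φ k Y Ts)) ∧
      -- extension stability on binary trees
      (∀ k, 1 ≤ k → ∀ Y X' : Set α, Y.Nonempty → Y ⊆ X' → X' ⊆ X →
        ∀ Ts : Fin k → Set (Set α), (∀ i, Ts i ∈ RBP X') →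
          φ k Y (fun i => restrictTree Y (Ts i)) ⊆ restrictTree Y (φ k X' Ts)) := by
  classical
  rintro ⟨φ, hRP, hun, han, hneu, hext⟩
  obtain ⟨a, b, c, d, e, hnd, hmem⟩ := exists_five X hX5
  have hnd' := hnd
  simp only [List.nodup_cons, List.mem_cons, List.not_mem_nil, not_or, or_false] at hnd'
  obtain ⟨⟨hab, hac, had, hae⟩, ⟨hbc, hbd, hbe⟩, ⟨hcd, hce⟩, hde, -⟩ := hnd'
  have sub : ∀ l : List α, (∀ x ∈ l, x ∈ [a, b, c, d, e]) → {y | y ∈ l} ⊆ X :=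
    fun l h y hy => hmem y (h y hy)
  -- the five-taxon profile and its output
  have hS1 : cat [c, d, a, b, e] ∈ RBP {y | y ∈ [a, b, c, d, e]} := by
    have h : {y | y ∈ [c, d, a, b, e]} = {y | y ∈ [a, b, c, d, e]} := by
      apply set_list_ext <;> simp
    rw [← h]; exact cat_RBP _ (by simp [hab, hac, had, hae, hbc, hbd, hbe, hcd, hce, hde, Ne.symm hac, Ne.symm had, Ne.symm hbc, Ne.symm hbd]) (by simp)
  have hS2 : cat [a, b, c, d, e] ∈ RBP {y | y ∈ [a, b, c, d, e]} := cat_RBP _ hnd (by simp)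
  have hV1 : cat [d, a, b, e] ∈ RBP {y | y ∈ [a, b, d, e]} := by
    have h : {y | y ∈ [d, a, b, e]} = {y | y ∈ [a, b, d, e]} := by
      apply set_list_ext <;> simp
    rw [← h]; exact cat_RBP _ (by simp [hab, hac, had, hae, hbc, hbd, hbe, hcd, hce, hde, Ne.symm hac, Ne.symm had, Ne.symm hbc, Ne.symm hbd]) (by simp)
  have hV2 : cat [a, b, d, e] ∈ RBP {y | y ∈ [a, b, d, e]} :=
    cat_RBP _ (by simp [hab, hac, had, hae, hbc, hbd, hbe, hcd, hce, hde, Ne.symm hac, Ne.symm had, Ne.symm hbc, Ne.symm hbd]) (by simp)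
  have hT : cat [a, b, e] ∈ RBP {y | y ∈ [a, b, e]} := cat_RBP _ (by simp [hab, hac, had, hae, hbc, hbd, hbe, hcd, hce, hde, Ne.symm hac, Ne.symm had, Ne.symm hbc, Ne.symm hbd]) (by simp)
  let S : Fin 2 → Set (Set α) := ![cat [c, d, a, b, e], cat [a, b, c, d, e]]
  let V : Fin 2 → Set (Set α) := ![cat [d, a, b, e], cat [a, b, d, e]]
  have hS : ∀ i, S i ∈ RBP {y | y ∈ [a, b, c, d, e]} := by
    intro i; fin_cases i; exacts [hS1, hS2]
  have hV : ∀ i, V i ∈ RBP {y | y ∈ [a, b, d, e]} := by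
    intro i; fin_cases i; exacts [hV1, hV2]
  have sX := sub [a, b, c, d, e] (by simp)
  have sY := sub [a, b, d, e] (by simp)
  have sY' := sub [a, b, c, e] (by simp)
  have sZ := sub [a, b, e] (by simp)
  have nX : {y | y ∈ [a, b, c, d, e]}.Nonempty := ⟨a, by simp⟩
  have nY : {y | y ∈ [a, b, d, e]}.Nonempty := ⟨a, by simp⟩
  have nY' : {y | y ∈ [a, b, c, e]}.Nonempty := ⟨a, by simp⟩
  have nZ : {y | y ∈ [a, b, e]}.Nonempty := ⟨a, by simp⟩
  have hW := hRP 2 (by simp) _ nX sX S hS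
  have hU := hRP 2 (by simp) _ nY sY V hV
  -- symmetry of the five-taxon output
  obtain ⟨σ, σa, σb, σc, σd, σe, σσ⟩ :=
    exists_sigma a b c d e hab hac had hae hbc hbd hbe hcd hce hde
  have σinj : Function.Injective σ := fun x y h => by rw [← σσ x, h, σσ]
  have σX : σ '' {y | y ∈ [a, b, c, d, e]} = {y | y ∈ [a, b, c, d, e]} := by
    have : σ '' {y | y ∈ [a, b, c, d, e]} = {y | y ∈ [a, b, c, d, e].map σ} := by
      ext y; simp [eq_comm]
    rw [this]
    apply set_list_ext <;> simp [σa, σb, σc, σd, σe]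
  have hsym : mapTree σ (φ 2 {y | y ∈ [a, b, c, d, e]} S) = φ 2 {y | y ∈ [a, b, c, d, e]} S := by
    rw [← hneu 2 (by simp) _ nX sX σ σinj.injOn (by rw [σX]; exact sX) S hS, σX,
      ← han 2 (by simp) _ nX sX S hS (Equiv.swap 0 1)]
    congr 1
    funext i
    fin_cases i <;> simp [S, cat_map, σa, σb, σc, σd, σe]
  have hσW : ∀ C ∈ φ 2 {y | y ∈ [a, b, c, d, e]} S, σ '' C ∈ φ 2 {y | y ∈ [a, b, c, d, e]} S := by
    intro C hC
    rw [← hsym]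
    exact ⟨C, hC, rfl⟩
  -- no cluster of the output contains `p`, `e` but not `σ p`
  have noC : ∀ C ∈ φ 2 {y | y ∈ [a, b, c, d, e]} S, ∀ p, p ∈ C → e ∈ C → σ p ∉ C → False := by
    intro C hC p hp he hq
    have m1 : e ∈ σ '' C := ⟨e, he, σe⟩
    have m2 : σ p ∈ σ '' C := ⟨p, hp, rfl⟩
    have m3 : p ∉ σ '' C := by
      rintro ⟨y, hy, rfl⟩
      rw [σσ] at hq
      exact hq hy
    rcases hW.2.2.2 C hC _ (hσW C hC) with h | h | h
    · have : e ∈ C ∩ σ '' C := ⟨he, m1⟩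
      rw [h] at this; exact this
    · rw [← h] at hp; exact m3 hp.2
    · rw [← h] at m2; exact hq m2.1
  -- the four-taxon output
  have hf := filt_aux a b d e hab had hae hbd hbe hde
  have hg := filt_aux2 a b c d e had hac hbd hbc hcd hde hce
  have hVr : (fun i => restrictTree {y | y ∈ [a, b, e]} (V i)) = fun _ => cat [a, b, e] := by
    funext i
    fin_cases i
    exacts [hf.1, hf.2]
  have h3 := hext 2 (by simp) {y | y ∈ [a, b, e]} _ nZ (set_list_sub _ _ (by simp)) sY V hV
  rw [hVr, hun 2 (by simp) _ nZ sZ _ hT] at h3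
  obtain ⟨C, hC, hCe, -⟩ := h3 (show {y | y ∈ [b, e]} ∈ cat [a, b, e] from
    Or.inr (cat_top [b, e] (by simp)))
  have haC : a ∉ C := fun h => by
    have : a ∈ C ∩ {y | y ∈ [a, b, e]} := ⟨h, by simp⟩
    rw [← hCe] at this
    simp [hab, hae] at this
  have hbC : b ∈ C := by
    have : b ∈ C ∩ {y | y ∈ [a, b, e]} := by rw [← hCe]; simp
    exact this.1
  have heC : e ∈ C := by
    have : e ∈ C ∩ {y | y ∈ [a, b, e]} := by rw [← hCe]; simp
    exact this.1
  by_cases hdC : d ∈ C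
  · -- move to the taxa `a, b, c, e`
    obtain ⟨τ, τa, τb, τd, τe, τinj⟩ := exists_tau a b c d e hac had hbc hbd hce hde
    have τY : τ '' {y | y ∈ [a, b, d, e]} = {y | y ∈ [a, b, c, e]} := by
      have : τ '' {y | y ∈ [a, b, d, e]} = {y | y ∈ [a, b, d, e].map τ} := by
        ext y; simp [eq_comm]
      rw [this]
      simp [τa, τb, τd, τe]
    have hn := hneu 2 (by simp) _ nY sY τ τinj.injOn (by rw [τY]; exact sY') V hV
    rw [τY] at hn
    have h4 := hext 2 (by simp) {y | y ∈ [a, b, c, e]} _ nY' (set_list_sub _ _ (by simp)) sX S hS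
    have hSr : (fun i => restrictTree {y | y ∈ [a, b, c, e]} (S i))
        = fun i => mapTree τ (V i) := by
      funext i
      fin_cases i
      · refine hg.1.trans (Eq.trans ?_ (cat_map τ _).symm)
        simp only [List.map, τa, τb, τd, τe]
      · refine hg.2.1.trans (Eq.trans ?_ (cat_map τ _).symm)
        simp only [List.map, τa, τb, τd, τe]
    rw [hSr, hn] at h4
    obtain ⟨D, hD, hDe, -⟩ := h4 ⟨C, hC, rfl⟩
    have e1 : c ∈ D := by
      have : c ∈ D ∩ {y | y ∈ [a, b, c, e]} := by rw [← hDe]; exact ⟨d, hdC, τd⟩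
      exact this.1
    have e2 : e ∈ D := by
      have : e ∈ D ∩ {y | y ∈ [a, b, c, e]} := by rw [← hDe]; exact ⟨e, heC, τe⟩
      exact this.1
    have e3 : a ∉ D := fun h => by
      have : a ∈ D ∩ {y | y ∈ [a, b, c, e]} := ⟨h, by simp⟩
      rw [← hDe] at this
      obtain ⟨y, hy, hya⟩ := this
      have := τinj (hya.trans τa.symm)
      exact haC (this ▸ hy)
    exact noC D hD c e1 e2 (by rw [σc]; exact e3)
  · have h4 := hext 2 (by simp) {y | y ∈ [a, b, d, e]} _ nY (set_list_sub _ _ (by simp)) sX S hS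
    have hSr : (fun i => restrictTree {y | y ∈ [a, b, d, e]} (S i)) = V := by
      funext i
      fin_cases i
      exacts [hg.2.2.1, hg.2.2.2]
    rw [hSr] at h4
    obtain ⟨D, hD, hDe, -⟩ := h4 hC
    have e1 : b ∈ D := by rw [hDe] at hbC; exact hbC.1
    have e2 : e ∈ D := by rw [hDe] at heC; exact heC.1
    have e3 : d ∉ D := fun h => hdC (by rw [hDe]; exact ⟨h, by simp⟩)
    exact noC D hD b e1 e2 (by rw [σb]; exact e3)
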